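/- arXiv:2208.06019 — 3 statements merged into one kernel-verified Lean document; each statement's English description precedes it below -/
import Mathlib

section
/- Let A be a unital C*-algebra, let τ be a state on A, let u ∈ A be a unitary element, and let a ∈ A. Suppose there is a sequence (aₙ) in A such that for every n: 0 ≤ aₙ ≤ 1 (in the C*-order), aₙ * a = a * aₙ, and such that τ(aₙ) → 1 and τ(star u * aₙ * u) → 0 as n → ∞. Then τ(a * u) = 0. (This is the core computation of Proposition 3.2 of the paper, which shows that Γ-singularity of the relative commutant forces the conditional expectation to vanish on off-diagonal terms a·λ(g).) -/
open scoped ComplexOrder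

namespace PositiveLinearMap

variable {A : Type*} [CStarAlgebra A] [PartialOrder A] [StarOrderedRing A]

/-- The Cauchy–Schwarz inequality for a positive linear functional. -/
lemma norm_apply_star_mul_sq_le (f : A →ₚ[ℂ] ℂ) (x y : A) :
    ‖f (star x * y)‖ ^ 2 ≤ (f (star x * x)).re * (f (star y * y)).re := by
  have hsq (z : A) : ‖f.toPreGNS z‖ ^ 2 = (f (star z * z)).re := by
    simpa [← Complex.ofReal_pow] using congrArg Complex.re (f.preGNS_norm_sq (f.toPreGNS z))
  have h := norm_inner_le_norm (𝕜 := ℂ) (f.toPreGNS x) (f.toPreGNS y)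
  rw [preGNS_inner_def] at h
  rw [← hsq, ← hsq, ← mul_pow]
  exact pow_le_pow_left₀ (norm_nonneg _) h 2

/-- A Cauchy–Schwarz inequality weighted by a positive contraction `b`. -/
lemma norm_apply_mul_mul_sq_le (f : A →ₚ[ℂ] ℂ) {b : A} (hb₀ : 0 ≤ b) (hb₁ : b ≤ 1) (x y : A) :
    ‖f (x * b * y)‖ ^ 2 ≤ (f (x * star x)).re * (f (star y * b * y)).re := by
  have hbb : b * b ≤ b := by
    simpa [sq] using CStarAlgebra.pow_antitone hb₀ hb₁ one_le_two
  have hmono : f (star (b * y) * (b * y)) ≤ f (star y * b * y) := by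
    refine OrderHomClass.mono f ?_
    simpa [(IsSelfAdjoint.of_nonneg hb₀).star_eq, mul_assoc] using
      star_left_conjugate_le_conjugate hbb y
  calc ‖f (x * b * y)‖ ^ 2 ≤ (f (x * star x)).re * (f (star (b * y) * (b * y))).re := by
        simpa [mul_assoc] using f.norm_apply_star_mul_sq_le (star x) (b * y)
    _ ≤ _ := mul_le_mul_of_nonneg_left (Complex.le_def.mp hmono).1
        (Complex.le_def.mp (f.map_nonneg (mul_star_self_nonneg x))).1

/-- If `f (star y * b n * y)` tends to zero for positive contractions `b n`, then so does
`f (x * b n * y)`. -/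
lemma tendsto_apply_mul_mul_zero (f : A →ₚ[ℂ] ℂ) {ι : Type*} {l : Filter ι} {b : ι → A}
    (hb₀ : ∀ n, 0 ≤ b n) (hb₁ : ∀ n, b n ≤ 1) (x y : A)
    (h : Filter.Tendsto (fun n => f (star y * b n * y)) l (nhds 0)) :
    Filter.Tendsto (fun n => f (x * b n * y)) l (nhds 0) := by
  have hre := ((Complex.continuous_re.tendsto 0).comp h).const_mul (f (x * star x)).re
  rw [Complex.zero_re, mul_zero] at hre
  have hsq := squeeze_zero (fun n => sq_nonneg ‖f (x * b n * y)‖)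
    (fun n => f.norm_apply_mul_mul_sq_le (hb₀ n) (hb₁ n) x y) hre
  rw [tendsto_zero_iff_norm_tendsto_zero]
  simpa using hsq.sqrt

end PositiveLinearMap

/-- core computation of Proposition 3.2:
If `τ` is a state on a unital C*-algebra `A`, `u ∈ A` is unitary, `a ∈ A`, and there is a
sequence `aseq` with `0 ≤ aseq n ≤ 1`, commuting with `a`, such that `τ (aseq n) → 1` and
`τ (u* (aseq n) u) → 0`, then `τ (a * u) = 0`. -/
theorem offdiagonal_vanishes_of_singular
    {A : Type*} [CStarAlgebra A] [PartialOrder A] [StarOrderedRing A]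
    (τ : A →ₗ[ℂ] ℂ) (hτ1 : τ 1 = 1) (hτpos : ∀ x : A, 0 ≤ τ (star x * x))
    (u : A) (hu : u ∈ unitary A) (a : A) (aseq : ℕ → A)
    (haseq0 : ∀ n, 0 ≤ aseq n) (haseq1 : ∀ n, aseq n ≤ 1)
    (hcomm : ∀ n, aseq n * a = a * aseq n)
    (hlim1 : Filter.Tendsto (fun n => τ (aseq n)) Filter.atTop (nhds 1))
    (hlim0 : Filter.Tendsto (fun n => τ (star u * aseq n * u)) Filter.atTop (nhds 0)) :
    τ (a * u) = 0 := by
  let f : A →ₚ[ℂ] ℂ := .mk₀ τ fun x hx => by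
    obtain ⟨y, rfl⟩ := CStarAlgebra.nonneg_iff_eq_star_mul_self.mp hx
    exact hτpos y
  have hleft : Filter.Tendsto (fun n => f (a * aseq n * u)) Filter.atTop (nhds 0) :=
    f.tendsto_apply_mul_mul_zero haseq0 haseq1 a u hlim0
  have hcompl : Filter.Tendsto (fun n => f (star (1 : A) * (1 - aseq n) * 1))
      Filter.atTop (nhds 0) := by
    have hfun : (fun n => f (star (1 : A) * (1 - aseq n) * 1)) = fun n => 1 - τ (aseq n) := by
      funext n
      rw [star_one, one_mul, mul_one, map_sub]
      exact congrArg (· - τ (aseq n)) hτ1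
    rw [hfun]
    simpa using hlim1.const_sub 1
  have hright := (f.tendsto_apply_mul_mul_zero (fun n => sub_nonneg.mpr (haseq1 n))
    (fun n => sub_le_self _ (haseq0 n)) (star (a * u)) 1 hcompl).star
  have hsum := hleft.add hright
  have hconst (n : ℕ) : f (a * aseq n * u) + star (f (star (a * u) * (1 - aseq n) * 1)) =
      τ (a * u) := by
    have hstar : star (star (a * u) * (1 - aseq n) * 1) = a * u - a * aseq n * u := by
      rw [mul_one, star_mul, star_star, star_sub, star_one,
        (IsSelfAdjoint.of_nonneg (haseq0 n)).star_eq, sub_mul, one_mul, ← mul_assoc, hcomm]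
    rw [← map_star f, hstar, map_sub, add_sub_cancel]
    rfl
  simp only [hconst, star_zero, add_zero] at hsum
  exact tendsto_nhds_unique tendsto_const_nhds hsum
end

section
/- Let A be a unital C*-algebra, let τ be a state on A, let u ∈ A be a unitary element, and let a ∈ A. Suppose (aₙ) is a sequence in A such that for every n: 0 ≤ aₙ ≤ 1 (in the C*-order) and aₙ * a = a * aₙ, and suppose τ(star u * aₙ * u) → 0 as n → ∞. Then τ(aₙ * a * u) → 0 as n → ∞. (First estimate in the proof of Proposition 3.2: |τ(aₙ a u)|² ≤ τ(a aₙ a*)·τ(u* aₙ u), via Cauchy–Schwarz applied to a·aₙ^{1/2} and aₙ^{1/2}·u.) -/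
open scoped ComplexOrder

/-- Cauchy–Schwarz inequality for a positive linear functional on a C⋆-algebra. -/
theorem PositiveLinearMap.norm_apply_star_mul_sq_le_s1
    {A : Type*} [NonUnitalCStarAlgebra A] [PartialOrder A] [StarOrderedRing A]
    (f : A →ₚ[ℂ] ℂ) (x y : A) :
    ‖f (star x * y)‖ ^ 2 ≤ ‖f (star x * x)‖ * ‖f (star y * y)‖ := by
  have norm_sq (z : A) : ‖f.toPreGNS z‖ ^ 2 = ‖f (star z * z)‖ := by
    have h := congrArg norm (f.preGNS_norm_sq (f.toPreGNS z))
    simpa using h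
  have h := norm_inner_le_norm (𝕜 := ℂ) (f.toPreGNS x) (f.toPreGNS y)
  rw [f.preGNS_inner_def, f.ofPreGNS_toPreGNS, f.ofPreGNS_toPreGNS] at h
  rw [← norm_sq, ← norm_sq, ← mul_pow]
  gcongr

/-- Cauchy–Schwarz inequality for the form `(x, y) ↦ f (star x * b * y)` with `0 ≤ b ≤ 1`, where
the first factor is bounded using `b ≤ 1`. -/
theorem PositiveLinearMap.norm_apply_mul_mul_sq_le_s1
    {A : Type*} [CStarAlgebra A] [PartialOrder A] [StarOrderedRing A]
    (f : A →ₚ[ℂ] ℂ) {b : A} (hb0 : 0 ≤ b) (hb1 : b ≤ 1) (x y : A) :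
    ‖f (x * b * y)‖ ^ 2 ≤ ‖f (x * star x)‖ * ‖f (star y * b * y)‖ := by
  have hx : ‖f (x * b * star x)‖ ≤ ‖f (x * star x)‖ := by
    apply CStarAlgebra.norm_le_norm_of_nonneg_of_le
    · exact map_nonneg f (star_right_conjugate_nonneg hb0 x)
    · simpa using OrderHomClass.mono f (star_right_conjugate_le_conjugate hb1 x)
  obtain ⟨c, rfl⟩ := CStarAlgebra.nonneg_iff_eq_star_mul_self.mp hb0
  have h := f.norm_apply_star_mul_sq_le_s1 (c * star x) (c * y)
  simp only [star_mul, star_star, ← mul_assoc] at h hx ⊢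
  exact h.trans (by gcongr)

/-- first estimate in the proof of Proposition 3.2:
If `τ` is a state on a unital C*-algebra `A`, `u` is unitary, `a ∈ A`, and `aseq` is a
sequence with `0 ≤ aseq n ≤ 1` commuting with `a` such that `τ (u* (aseq n) u) → 0`, then
`τ ((aseq n) * a * u) → 0`. -/
theorem first_estimate
    {A : Type*} [CStarAlgebra A] [PartialOrder A] [StarOrderedRing A]
    (τ : A →ₗ[ℂ] ℂ) (hτ1 : τ 1 = 1) (hτpos : ∀ x : A, 0 ≤ τ (star x * x))
    (u : A) (hu : u ∈ unitary A) (a : A) (aseq : ℕ → A)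
    (haseq0 : ∀ n, 0 ≤ aseq n) (haseq1 : ∀ n, aseq n ≤ 1)
    (hcomm : ∀ n, aseq n * a = a * aseq n)
    (hlim0 : Filter.Tendsto (fun n => τ (star u * aseq n * u)) Filter.atTop (nhds 0)) :
    Filter.Tendsto (fun n => τ (aseq n * a * u)) Filter.atTop (nhds 0) := by
  let f : A →ₚ[ℂ] ℂ := .mk₀ τ fun x hx ↦ by
    obtain ⟨c, rfl⟩ := CStarAlgebra.nonneg_iff_eq_star_mul_self.mp hx
    exact hτpos c
  have hbound (n : ℕ) :
      ‖τ (aseq n * a * u)‖ ^ 2 ≤ ‖τ (a * star a)‖ * ‖τ (star u * aseq n * u)‖ := by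
    rw [hcomm n]
    exact f.norm_apply_mul_mul_sq_le_s1 (haseq0 n) (haseq1 n) a u
  have hsq : Filter.Tendsto (fun n ↦ ‖τ (aseq n * a * u)‖ ^ 2) Filter.atTop (nhds 0) :=
    squeeze_zero (fun _ ↦ by positivity) hbound (by simpa using hlim0.norm.const_mul _)
  rw [tendsto_zero_iff_norm_tendsto_zero]
  simpa using hsq.sqrt
end

section
/- Let A be a unital C*-algebra, let M ⊆ A be a *-subalgebra, and let N ⊆ M be a *-subalgebra. Let E : A → A be a map such that E(x) ∈ N for every x ∈ M, and which is an N-bimodule map on M, i.e., E(n * x) = n * E(x) and E(x * n) = E(x) * n for all n ∈ N and x ∈ M. Let u ∈ M be a unitary element of A such that star u * n * u ∈ N for every n ∈ N. Then E(u) * star u commutes with every element of N: for all n ∈ N, (E(u) * star u) * n = n * (E(u) * star u). (Lemma 4.2 of the paper: for a conditional expectation E onto a subalgebra N that is invariant under conjugation by the unitary u, the element E(u)u* lies in the relative commutant of N.) -/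
/-- Lemma 4.2 of the paper:
Let `N ≤ M` be *-subalgebras of a unital C*-algebra `A`, let `E : A → A` be a map with
`E x ∈ N` for `x ∈ M` which is an `N`-bimodule map on `M`, and let `u ∈ M` be a unitary
element with `star u * n * u ∈ N` for all `n ∈ N`.  Then `E u * star u` commutes with every
element of `N`. -/
theorem expectation_of_unitary_in_relative_commutant
    {A : Type*} [CStarAlgebra A]
    (M N : StarSubalgebra ℂ A) (hNM : N ≤ M)
    (E : A → A)
    (hrange : ∀ x ∈ M, E x ∈ N)
    (hbimod_left : ∀ n ∈ N, ∀ x ∈ M, E (n * x) = n * E x)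
    (hbimod_right : ∀ n ∈ N, ∀ x ∈ M, E (x * n) = E x * n)
    (u : A) (huM : u ∈ M) (hu : u ∈ unitary A)
    (hconj : ∀ n ∈ N, star u * n * u ∈ N) :
    ∀ n ∈ N, (E u * star u) * n = n * (E u * star u) := by
  intro n hn
  have huu : u * star u = 1 := Unitary.mul_star_self_of_mem hu
  have key : n * E u = E u * (star u * n * u) := by
    rw [← hbimod_left n hn u huM, ← hbimod_right _ (hconj n hn) u huM]
    congr 1
    rw [← mul_assoc, ← mul_assoc, huu, one_mul]
  rw [← mul_assoc n, key]
  simp only [mul_assoc, huu, mul_one]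
end
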